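/- For every pair f = (f₁,f₂) with f₁, f₂ ∈ C^∞(cl B⁵; ℂ) and every ε > 0, there exists u = (u₁,u₂) with u₁ ∈ C⁴(cl B⁵;ℂ), u₂ ∈ C³(cl B⁵;ℂ) such that ‖(3/2)u − L̃u − f‖_{H³(B⁵)×H²(B⁵)} < ε, i.e. ‖(3/2)u₁ + ξ^j∂_ju₁ + u₁ − u₂ − f₁‖²_{H³(B⁵)} + ‖(3/2)u₂ − Δu₁ + ξ^j∂_ju₂ + 2u₂ − f₂‖²_{H²(B⁵)} < ε². In other words, the range of (3/2) − L̃ is dense in H³(B⁵) × H²(B⁵). -/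

import Mathlib

open MeasureTheory

noncomputable section

abbrev E5 : Type := EuclideanSpace ℝ (Fin 5)

/-- the partial derivative in the `i`-th coordinate direction -/
def pd (i : Fin 5) (f : E5 → ℂ) : E5 → ℂ :=
  fun x => fderiv ℝ f x (EuclideanSpace.single i 1)

/-- the iterated partial derivative `∂^β` for a multi-index `β` -/
def pdM (β : Fin 5 → ℕ) (f : E5 → ℂ) : E5 → ℂ :=
  (List.finRange 5).foldr (fun i g => (pd i)^[β i] g) f

/-- the Laplacian `Δf = ∑_j ∂_j∂_j f` -/
def lap (f : E5 → ℂ) : E5 → ℂ := fun x => ∑ j : Fin 5, pd j (pd j f) x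

/-- the open unit ball `B⁵ ⊆ ℝ⁵` -/
def ball5 : Set E5 := Metric.ball 0 1

/-- the squared `L²` norm over the unit ball -/
def bL2Sq (f : E5 → ℂ) : ℝ := ∫ x in ball5, ‖f x‖ ^ 2

/-- the squared `H^m(B⁵)` norm: `∑_{|β| ≤ m} ‖∂^β f‖²_{L²(B⁵)}` -/
def HSq (m : ℕ) (f : E5 → ℂ) : ℝ :=
  ∑ β : Fin 5 → Fin (m + 1),
    if (∑ i, (β i : ℕ)) ≤ m then bL2Sq (pdM (fun i => (β i : ℕ)) f) else 0

/-! ### Polynomials -/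

/-- evaluation of a polynomial as a function on `E5` -/
def ev (p : MvPolynomial (Fin 5) ℂ) : E5 → ℂ :=
  fun x => MvPolynomial.eval (fun i => (x i : ℂ)) p

open MvPolynomial in
theorem ev_contDiff (p : MvPolynomial (Fin 5) ℂ) : ContDiff ℝ (⊤ : ℕ∞) (ev p) := by
  unfold ev
  induction p using MvPolynomial.induction_on with
  | C a => simpa using contDiff_const
  | add p q hp hq => simpa using hp.add hq
  | mul_X p i hp =>
    simp only [map_mul, eval_X]
    refine hp.mul ?_
    have : ContDiff ℝ (⊤ : ℕ∞) (fun x : E5 => x i) := by fun_prop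
    exact Complex.ofRealCLM.contDiff.comp this

theorem hasFDerivAt_coord (i : Fin 5) (x : E5) :
    HasFDerivAt (fun x : E5 => ((x i : ℝ) : ℂ))
      (Complex.ofRealCLM.comp (EuclideanSpace.proj i : E5 →L[ℝ] ℝ)) x :=
  (Complex.ofRealCLM.comp (EuclideanSpace.proj i : E5 →L[ℝ] ℝ)).hasFDerivAt

theorem pd_add {i : Fin 5} {f g : E5 → ℂ} {x : E5} (hf : DifferentiableAt ℝ f x)
    (hg : DifferentiableAt ℝ g x) : pd i (fun y => f y + g y) x = pd i f x + pd i g x := by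
  simp [pd, fderiv_fun_add hf hg]

theorem pd_sub {i : Fin 5} {f g : E5 → ℂ} {x : E5} (hf : DifferentiableAt ℝ f x)
    (hg : DifferentiableAt ℝ g x) : pd i (fun y => f y - g y) x = pd i f x - pd i g x := by
  simp [pd, fderiv_fun_sub hf hg]

open MvPolynomial in
theorem pd_ev (i : Fin 5) (p : MvPolynomial (Fin 5) ℂ) : pd i (ev p) = ev (pderiv i p) := by
  funext x
  induction p using MvPolynomial.induction_on with
  | C a =>
    have : ev (C a) = fun _ => a := by funext y; simp [ev]
    rw [this]; simp [pd, ev]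
  | add p q hp hq =>
    have : ev (p + q) = fun y => ev p y + ev q y := by funext y; simp [ev]
    rw [this, pd_add ((ev_contDiff p).differentiable (by simp) x)
      ((ev_contDiff q).differentiable (by simp) x), hp, hq]
    simp [ev]
  | mul_X p j hp =>
    have : ev (p * X j) = fun y => ev p y * ((y j : ℝ) : ℂ) := by funext y; simp [ev]
    have h := ((ev_contDiff p).differentiable (by simp) x).hasFDerivAt.mul (hasFDerivAt_coord j x)
    rw [this]
    unfold pd at hp ⊢
    have h' := h.fderiv
    simp only [Pi.mul_def] at h'
    rw [h']
    simp only [ContinuousLinearMap.add_apply, ContinuousLinearMap.smul_apply, hp]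
    simp only [ev, Derivation.leibniz, smul_eq_mul, map_add, map_mul, eval_X, pderiv_X]
    by_cases hij : j = i
    · subst hij; simp
    · simp [hij, Pi.single_apply, Ne.symm hij]

open MvPolynomial in
/-- the second order operator on polynomials -/
def Pop (p : MvPolynomial (Fin 5) ℂ) : MvPolynomial (Fin 5) ℂ :=
  let q := C (5 / 2) * p + ∑ j, X j * pderiv j p
  C (7 / 2) * q + ∑ j, X j * pderiv j q - ∑ j, pderiv j (pderiv j p)

theorem Pop_add (p q : MvPolynomial (Fin 5) ℂ) : Pop (p + q) = Pop p + Pop q := by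
  simp only [Pop, map_add, map_sum, mul_add, Finset.sum_add_distrib, Finset.mul_sum]
  ring

open MvPolynomial in
theorem Pop_hom (n : ℕ) (p : MvPolynomial (Fin 5) ℂ) (hp : p.IsHomogeneous n) :
    Pop p = C (((n : ℂ) + 7 / 2) * ((n : ℂ) + 5 / 2)) * p - ∑ j, pderiv j (pderiv j p) := by
  have e := hp.sum_X_mul_pderiv
  have e2 : (C (5 / 2 : ℂ) * p + ∑ j, X j * pderiv j p) = C (n + 5 / 2 : ℂ) * p := by
    rw [e, nsmul_eq_mul]; simp; ring
  have h2 : (C (n + 5 / 2 : ℂ) * p).IsHomogeneous n := by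
    simpa using (isHomogeneous_C (Fin 5) (n + 5 / 2 : ℂ)).mul hp
  simp only [Pop]
  rw [e2, h2.sum_X_mul_pderiv, nsmul_eq_mul]
  simp; ring

open MvPolynomial in
theorem Pop_surj_hom (n : ℕ) : ∀ (p : MvPolynomial (Fin 5) ℂ), p.IsHomogeneous n →
    ∃ q, Pop q = p := by
  induction n using Nat.strong_induction_on with
  | _ n ih =>
  intro p hp
  set c : ℂ := (n + 7 / 2) * (n + 5 / 2) with hc
  have hc0 : c ≠ 0 := by
    have : c = (((n + 7 / 2) * (n + 5 / 2) : ℝ) : ℂ) := by push_cast; rfl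
    rw [this]
    exact_mod_cast (by positivity : ((n + 7 / 2) * (n + 5 / 2) : ℝ) ≠ 0)
  have h1 : (C c⁻¹ * p).IsHomogeneous n := by
    simpa using (isHomogeneous_C (Fin 5) c⁻¹).mul hp
  have key : Pop (C c⁻¹ * p) = p - ∑ j, pderiv j (pderiv j (C c⁻¹ * p)) := by
    rw [Pop_hom n _ h1, ← mul_assoc, ← C_mul, ← hc, mul_inv_cancel₀ hc0]; simp
  have h2 : (∑ j, pderiv j (pderiv j (C c⁻¹ * p))).IsHomogeneous (n - 1 - 1) :=
    IsHomogeneous.sum _ _ _ fun j _ => h1.pderiv.pderiv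
  rcases Nat.eq_zero_or_pos n with h0 | h0
  · subst h0
    refine ⟨C c⁻¹ * p, ?_⟩
    rw [← totalDegree_zero_iff_isHomogeneous, totalDegree_eq_zero_iff_eq_C] at h1
    rw [key, h1]; simp
  · obtain ⟨q, hq⟩ := ih (n - 1 - 1) (by omega) _ h2
    exact ⟨C c⁻¹ * p + q, by rw [Pop_add, key, hq]; ring⟩

open MvPolynomial in
theorem Pop_surj (p : MvPolynomial (Fin 5) ℂ) : ∃ q, Pop q = p := by
  rw [← sum_homogeneousComponent p]
  refine Finset.sum_induction _ (fun p => ∃ q, Pop q = p) ?_ ?_ ?_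
  · rintro _ _ ⟨q, rfl⟩ ⟨r, rfl⟩; exact ⟨q + r, Pop_add _ _⟩
  · exact ⟨0, by simp [Pop]⟩
  · intro i _; exact Pop_surj_hom i _ (homogeneousComponent_isHomogeneous i p)

/-! ### Landau kernels -/

def cK (y : E5) : ℝ := 1 - ‖y‖ ^ 2 / 9

theorem cK_cont : Continuous cK := by unfold cK; fun_prop

def sB : Set E5 := Metric.closedBall 0 3

/-- smoothing with the Landau kernel -/
def conv (n : ℕ) (f : E5 → ℂ) : E5 → ℂ := fun x =>
  (∫ y in sB, cK y ^ n)⁻¹ • (convolution (fun y => cK y ^ n) f (ContinuousLinearMap.lsmul ℝ ℝ) volume x)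

def Good (f : E5 → ℂ) : Prop := ContDiff ℝ (⊤ : ℕ∞) f ∧ ∀ x, 2 < ‖x‖ → f x = 0

theorem Good.hcs {f : E5 → ℂ} (hf : Good f) : HasCompactSupport f := by
  refine HasCompactSupport.intro (isCompact_closedBall (0 : E5) 2) fun x hx => hf.2 x ?_
  simpa using hx

theorem pd_contDiff {f : E5 → ℂ} (i : Fin 5) (hf : ContDiff ℝ (⊤ : ℕ∞) f) :
    ContDiff ℝ (⊤ : ℕ∞) (pd i f) := by
  unfold pd
  exact (hf.fderiv_right (m := (⊤ : ℕ∞)) (by simp)).clm_apply contDiff_const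

theorem pd_congr {f g : E5 → ℂ} (i : Fin 5) {U : Set E5} (hU : IsOpen U)
    (h : ∀ x ∈ U, f x = g x) : ∀ x ∈ U, pd i f x = pd i g x := by
  intro x hx
  have : f =ᶠ[nhds x] g := Filter.eventually_of_mem (hU.mem_nhds hx) h
  simp [pd, this.fderiv_eq]

theorem Good.pd {f : E5 → ℂ} (hf : Good f) (i : Fin 5) : Good (pd i f) := by
  refine ⟨pd_contDiff i hf.1, fun x hx => ?_⟩
  have := pd_congr (f := f) (g := fun _ => 0) i (U := {x | 2 < ‖x‖})
    (isOpen_lt continuous_const continuous_norm) hf.2 x hx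
  rw [this]; simp [_root_.pd]

theorem conv_hasFDerivAt (n : ℕ) {f : E5 → ℂ} (hf : Good f) (i : Fin 5) (x : E5) :
    DifferentiableAt ℝ (conv n f) x ∧ pd i (conv n f) x = conv n (pd i f) x := by
  have hloc : LocallyIntegrable (fun y => cK y ^ n) (volume : Measure E5) :=
    (cK_cont.pow n).locallyIntegrable
  have h := (hf.hcs.hasFDerivAt_convolution_right (ContinuousLinearMap.lsmul ℝ ℝ) hloc
    (hf.1.of_le (by simp)) x).const_smul (∫ y in sB, cK y ^ n)⁻¹
  refine ⟨h.differentiableAt, ?_⟩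
  have h2 : pd i (conv n f) x = _ := congrArg (fun L => L (EuclideanSpace.single i 1)) h.fderiv
  rw [h2]
  simp only [ContinuousLinearMap.smul_apply]
  rw [convolution_precompR_apply _ hloc (hf.hcs.fderiv ℝ) (hf.1.continuous_fderiv (by simp))]
  rfl

/-- the relation propagated through the derivatives -/
def LRel (n : ℕ) (f k : E5 → ℂ) : Prop :=
  Good f ∧ ∀ x ∈ ball5, k x = conv n f x - f x

theorem LRel.pd {n : ℕ} {f k : E5 → ℂ} (h : LRel n f k) (i : Fin 5) : LRel n (pd i f) (pd i k) := by
  refine ⟨h.1.pd i, fun x hx => ?_⟩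
  rw [pd_congr i Metric.isOpen_ball h.2 x hx,
    pd_sub (conv_hasFDerivAt n h.1 i x).1 (h.1.1.differentiable (by simp) x),
    (conv_hasFDerivAt n h.1 i x).2]

theorem pdM_rel (R : (E5 → ℂ) → (E5 → ℂ) → Prop)
    (hR : ∀ i f k, R f k → R (pd i f) (pd i k)) (β : Fin 5 → ℕ) {f k : E5 → ℂ} (h : R f k) :
    R (pdM β f) (pdM β k) := by
  have it : ∀ i m f k, R f k → R ((pd i)^[m] f) ((pd i)^[m] k) := by
    intro i m
    induction m with
    | zero => intro f k h; exact h
    | succ m ih => intro f k h; exact ih _ _ (hR i _ _ h)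
  unfold pdM
  generalize List.finRange 5 = l
  induction l with
  | nil => exact h
  | cons a l ih => exact it _ _ _ _ ih

theorem conv_eq (n : ℕ) {f : E5 → ℂ} (hf : Good f) {x : E5} (hx : x ∈ ball5) :
    conv n f x = (∫ y in sB, cK y ^ n)⁻¹ • ∫ y in sB, cK y ^ n • f (x - y) := by
  unfold conv
  congr 1
  rw [convolution_def]
  simp only [ContinuousLinearMap.lsmul_apply]
  rw [setIntegral_eq_integral_of_forall_compl_eq_zero]
  intro y hy
  rw [hf.2, smul_zero]
  simp only [sB, Metric.mem_closedBall, dist_zero_right, not_le] at hy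
  simp only [ball5, Metric.mem_ball, dist_zero_right] at hx
  have := norm_sub_norm_le y x
  rw [norm_sub_rev] at this
  linarith

theorem cK_nonneg {y : E5} (hy : y ∈ sB) : 0 ≤ cK y := by
  simp only [sB, Metric.mem_closedBall, dist_zero_right] at hy
  unfold cK
  nlinarith [norm_nonneg y]

theorem sB_compact : IsCompact sB := isCompact_closedBall _ _

theorem conv_tendsto {f : E5 → ℂ} (hf : Good f) {x : E5} (hx : x ∈ ball5) :
    Filter.Tendsto (fun n => conv n f x) Filter.atTop (nhds (f x)) := by
  have := tendsto_setIntegral_pow_smul_of_unique_maximum_of_isCompact_of_continuousOn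
    (μ := (volume : Measure E5)) (s := sB) (x₀ := 0) (c := cK) (g := fun y => f (x - y))
    sB_compact cK_cont.continuousOn ?_ (fun _ => cK_nonneg) (by simp [cK]) ?_ ?_
  · simp only [sub_zero] at this
    exact this.congr fun n => (conv_eq n hf hx).symm
  · intro y _ hy0
    have : 0 < ‖y‖ := norm_pos_iff.2 hy0
    simp only [cK, norm_zero]
    have : 0 < ‖y‖ ^ 2 := by positivity
    linarith
  · apply subset_closure
    rw [sB, interior_closedBall _ (by norm_num)]
    simp
  · exact (hf.1.continuous.comp (continuous_const.sub continuous_id)).continuousOn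

theorem conv_bound {f : E5 → ℂ} (hf : Good f) {M : ℝ} (hM : ∀ x, ‖f x‖ ≤ M) (n : ℕ) {x : E5}
    (hx : x ∈ ball5) : ‖conv n f x‖ ≤ M := by
  have hM0 : 0 ≤ M := (norm_nonneg _).trans (hM 0)
  rw [conv_eq n hf hx, norm_smul]
  have hI : IntegrableOn (fun y => cK y ^ n) sB :=
    (cK_cont.pow n).continuousOn.integrableOn_compact sB_compact
  have h0 : 0 ≤ ∫ y in sB, cK y ^ n :=
    setIntegral_nonneg sB_compact.measurableSet fun y hy => pow_nonneg (cK_nonneg hy) n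
  have h1 : ‖∫ y in sB, cK y ^ n • f (x - y)‖ ≤ ∫ y in sB, cK y ^ n * M := by
    refine norm_integral_le_of_norm_le (hI.mul_const M) ?_
    filter_upwards [ae_restrict_mem sB_compact.measurableSet] with y hy
    rw [norm_smul, Real.norm_of_nonneg (pow_nonneg (cK_nonneg hy) n)]
    exact mul_le_mul_of_nonneg_left (hM _) (pow_nonneg (cK_nonneg hy) n)
  rw [integral_mul_const] at h1
  rw [Real.norm_of_nonneg (inv_nonneg.2 h0)]
  refine (mul_le_mul_of_nonneg_left h1 (inv_nonneg.2 h0)).trans ?_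
  rw [← mul_assoc]
  exact mul_le_of_le_one_left hM0 inv_mul_le_one

theorem conv_cont (n : ℕ) {f : E5 → ℂ} (hf : Good f) : Continuous (conv n f) :=
  continuous_iff_continuousAt.2 fun x => (conv_hasFDerivAt n hf 0 x).1.continuousAt

theorem bL2_tendsto {f : E5 → ℂ} (hf : Good f) :
    Filter.Tendsto (fun n => bL2Sq (fun x => conv n f x - f x)) Filter.atTop (nhds 0) := by
  obtain ⟨M, hM⟩ := hf.hcs.exists_bound_of_continuous hf.1.continuous
  have : (0 : ℝ) = ∫ x in ball5, (0 : ℝ) := by simp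
  rw [this]
  unfold bL2Sq
  have : IsFiniteMeasure ((volume : Measure E5).restrict ball5) :=
    isFiniteMeasure_restrict.2 Metric.isBounded_ball.measure_lt_top.ne
  refine tendsto_integral_of_dominated_convergence (fun _ => (2 * M) ^ 2) ?_ ?_ ?_ ?_
  · intro n
    exact (((conv_cont n hf).sub hf.1.continuous).norm.pow 2).aestronglyMeasurable
  · exact integrable_const _
  · intro n
    filter_upwards [ae_restrict_mem Metric.isOpen_ball.measurableSet] with x hx
    rw [norm_pow, norm_norm]
    gcongr
    calc _ ≤ _ := norm_sub_le _ _
      _ ≤ 2 * M := by linarith [conv_bound hf hM n hx, hM x]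
  · filter_upwards [ae_restrict_mem Metric.isOpen_ball.measurableSet] with x hx
    have := (((conv_tendsto hf hx).sub_const (f x)).norm.pow 2)
    simpa using this

/-! ### Smoothed functions are polynomials -/

open MvPolynomial in
def kerP (n : ℕ) : MvPolynomial (Fin 5) C(E5, ℂ) :=
  (1 - C (ContinuousMap.const _ (1 / 9 : ℂ)) *
    ∑ i, (X i - C ⟨fun y : E5 => ((y i : ℝ) : ℂ), by fun_prop⟩) ^ 2) ^ n

open MvPolynomial in
theorem kerP_eval (n : ℕ) (x y : E5) :
    ((cK (x - y) ^ n : ℝ) : ℂ) =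
      (MvPolynomial.eval (fun i => ContinuousMap.const E5 (x i : ℂ)) (kerP n)) y := by
  simp only [kerP, cK, EuclideanSpace.norm_sq_eq, map_pow, map_sub, map_mul, map_sum, eval_X,
    eval_C, map_one, ContinuousMap.coe_pow, Pi.pow_apply, ContinuousMap.sub_apply,
    ContinuousMap.mul_apply, ContinuousMap.one_apply, ContinuousMap.const_apply,
    ContinuousMap.coe_sum, Finset.sum_apply, ContinuousMap.coe_mk, Real.norm_eq_abs, sq_abs,
    PiLp.sub_apply]
  push_cast
  ring

open MvPolynomial in
theorem conv_poly (n : ℕ) {f : E5 → ℂ} (hf : Good f) : ∃ p, conv n f = ev p := by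
  refine ⟨∑ d ∈ (kerP n).support, monomial d
    (((∫ y in sB, cK y ^ n)⁻¹ : ℝ) * ∫ y, (kerP n).coeff d y * f y), ?_⟩
  funext x
  simp only [conv, ev, convolution_lsmul_swap, map_sum, eval_monomial]
  rw [Complex.real_smul]
  have : ∀ y, cK (x - y) ^ n • f y = ∑ d ∈ (kerP n).support,
      (d.prod fun i e => (x i : ℂ) ^ e) * ((kerP n).coeff d y * f y) := by
    intro y
    rw [Complex.real_smul, kerP_eval, eval_eq, ContinuousMap.coe_sum, Finset.sum_apply,
      Finset.sum_mul]
    refine Finset.sum_congr rfl fun d _ => ?_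
    simp [Finsupp.prod, ContinuousMap.mul_apply, ContinuousMap.coe_prod]
    ring
  simp_rw [this]
  rw [integral_finsetSum, Finset.mul_sum]
  · refine Finset.sum_congr rfl fun d _ => ?_
    rw [integral_const_mul]; ring
  · intro d _
    refine Integrable.const_mul ?_ _
    exact (((kerP n).coeff d).continuous.mul hf.1.continuous).integrable_of_hasCompactSupport
      hf.hcs.mul_left

/-- density of polynomials -/
theorem poly_dense (m : ℕ) (g : E5 → ℂ) (hg : ContDiff ℝ (⊤ : ℕ∞) g) (δ : ℝ) (hδ : 0 < δ) :
    ∃ p, HSq m (fun x => ev p x - g x) < δ := by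
  let χ : ContDiffBump (0 : E5) := ⟨1, 2, by norm_num, by norm_num⟩
  let f : E5 → ℂ := fun x => χ x • g x
  have hf : Good f := by
    refine ⟨χ.contDiff.smul hg, fun x hx => ?_⟩
    simp only [f]
    rw [χ.zero_of_le_dist (by simpa [χ] using hx.le), zero_smul]
  have hfg : ∀ x ∈ ball5, f x = g x := by
    intro x hx
    simp only [f]
    rw [χ.one_of_mem_closedBall (Metric.ball_subset_closedBall hx), one_smul]
  choose p hp using fun n => conv_poly n hf
  have hT : Filter.Tendsto (fun n => HSq m (fun x => ev (p n) x - g x)) Filter.atTop (nhds 0) := by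
    have : (0 : ℝ) = ∑ β : Fin 5 → Fin (m + 1), 0 := by simp
    rw [this]
    refine tendsto_finsetSum _ fun β _ => ?_
    split_ifs
    · have hr : ∀ n, LRel n (pdM (fun i => (β i : ℕ)) f)
          (pdM (fun i => (β i : ℕ)) (fun x => ev (p n) x - g x)) := fun n =>
        pdM_rel (LRel n) (fun i f k h => h.pd i) _
          ⟨hf, fun x hx => by rw [← hp, hfg x hx]⟩
      refine (bL2_tendsto (hr 0).1).congr fun n => ?_
      refine setIntegral_congr_fun Metric.isOpen_ball.measurableSet fun x hx => ?_
      simp only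
      rw [(hr n).2 x hx]
    · exact tendsto_const_nhds
  obtain ⟨n, hn⟩ := (hT.eventually (gt_mem_nhds hδ)).exists
  exact ⟨p n, hn⟩

theorem HSq_zero (m : ℕ) : HSq m (fun _ => 0) = 0 := by
  have : ∀ β, pdM β (fun _ => (0 : ℂ)) = fun _ => 0 := fun β =>
    pdM_rel (fun _ k => k = fun _ => 0) (by rintro i f k rfl; funext x; simp [pd]) β
      (f := fun _ => 0) rfl
  simp [HSq, this, bL2Sq]

/-- Lemma 4.8 (Lumer2): the range of `3/2 − L̃` is dense in `H³(B⁵) × H²(B⁵)`: for all smooth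
`f₁, f₂` and `ε > 0` there are `u₁ ∈ C⁴(cl B⁵)`, `u₂ ∈ C³(cl B⁵)` with
`‖(3/2)u − L̃u − f‖²_{H³(B⁵)×H²(B⁵)} < ε²`. -/
theorem stmt_9 (f₁ f₂ : E5 → ℂ) (hf₁ : ContDiff ℝ (⊤ : ℕ∞) f₁)
    (hf₂ : ContDiff ℝ (⊤ : ℕ∞) f₂) (ε : ℝ) (hε : 0 < ε) :
    ∃ u₁ u₂ : E5 → ℂ, ContDiff ℝ 4 u₁ ∧ ContDiff ℝ 3 u₂ ∧
      HSq 3 (fun ξ : E5 =>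
          (3 / 2) * u₁ ξ + (∑ j : Fin 5, (ξ j : ℂ) * pd j u₁ ξ) + u₁ ξ - u₂ ξ - f₁ ξ) +
        HSq 2 (fun ξ : E5 =>
          (3 / 2) * u₂ ξ - lap u₁ ξ + (∑ j : Fin 5, (ξ j : ℂ) * pd j u₂ ξ) + 2 * u₂ ξ - f₂ ξ)
        < ε ^ 2 := by
  let T : (E5 → ℂ) → E5 → ℂ := fun f ξ => ∑ j : Fin 5, (ξ j : ℂ) * pd j f ξ
  have hT : ∀ f, ContDiff ℝ (⊤ : ℕ∞) f → ContDiff ℝ (⊤ : ℕ∞) (T f) := by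
    intro f hf
    refine ContDiff.sum fun j _ => ContDiff.mul ?_ (pd_contDiff j hf)
    exact (Complex.ofRealCLM.comp (EuclideanSpace.proj j : E5 →L[ℝ] ℝ)).contDiff
  have hTev : ∀ p, T (ev p) = ev (∑ j, MvPolynomial.X j * MvPolynomial.pderiv j p) := by
    intro p; funext x; simp [T, pd_ev, ev]
  let g : E5 → ℂ := fun ξ => f₂ ξ + (7 / 2 * f₁ ξ + T f₁ ξ)
  have hg : ContDiff ℝ (⊤ : ℕ∞) g := hf₂.add ((contDiff_const.mul hf₁).add (hT _ hf₁))
  obtain ⟨p, hp⟩ := poly_dense 2 g hg (ε ^ 2) (by positivity)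
  obtain ⟨q, hq⟩ := Pop_surj p
  let r := MvPolynomial.C (5 / 2) * q + ∑ j, MvPolynomial.X j * MvPolynomial.pderiv j q
  have hr : ev r = fun ξ => 5 / 2 * ev q ξ + T (ev q) ξ := by
    rw [hTev]; funext x; simp [r, ev]
  refine ⟨ev q, fun ξ => ev r ξ - f₁ ξ, (ev_contDiff q).of_le (WithTop.coe_le_coe.2 le_top),
    ((ev_contDiff r).sub hf₁).of_le (WithTop.coe_le_coe.2 le_top), ?_⟩
  have e1 : (fun ξ : E5 => (3 / 2) * ev q ξ + (∑ j : Fin 5, (ξ j : ℂ) * pd j (ev q) ξ) + ev q ξ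
      - (ev r ξ - f₁ ξ) - f₁ ξ) = fun _ => 0 := by
    funext ξ
    rw [hr]
    simp only [T]
    ring
  have e2 : (fun ξ : E5 => (3 / 2) * (ev r ξ - f₁ ξ) - lap (ev q) ξ
      + (∑ j : Fin 5, (ξ j : ℂ) * pd j (fun ξ => ev r ξ - f₁ ξ) ξ) + 2 * (ev r ξ - f₁ ξ) - f₂ ξ)
      = fun ξ => ev p ξ - g ξ := by
    funext ξ
    have h1 : ∀ j, pd j (fun ξ => ev r ξ - f₁ ξ) ξ = pd j (ev r) ξ - pd j f₁ ξ := fun j =>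
      pd_sub ((ev_contDiff r).differentiable (by simp) ξ) (hf₁.differentiable (by simp) ξ)
    have h2 : ev p ξ = 7 / 2 * ev r ξ + T (ev r) ξ - lap (ev q) ξ := by
      rw [← hq, hTev]
      simp [Pop, r, lap, pd_ev, ev]
    rw [h2]
    simp only [h1, g, T, mul_sub, Finset.sum_sub_distrib]
    ring
  rw [e1, e2, HSq_zero, zero_add]
  exact hp

end
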